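/- Let N = N_0 ⊕ … ⊕ N_c = S^v/L be an Artinian graded S-module generated in degree zero (L a homogeneous submodule of S^v generated in positive degrees), with N_0 ≠ 0 and N_c ≠ 0, and suppose N is Symmetrically Gorenstein. Set j = ⌊(c−1)/2⌋. Then, as sets, L_N = L_{N,j}; that is, a linear form ℓ ∈ S_1 is a Lefschetz element of N if and only if ×ℓ : N_j → N_{j+1} has maximal rank. -/

import Mathlib

open MvPolynomial

noncomputable section

/-- The degree-`z` homogeneous component of `K[x₁, …, x_r]`, for `z : ℤ`
(it is zero in negative degrees). -/
def hcomp (K : Type*) [Field K] (r : ℕ) (z : ℤ) : Submodule K (MvPolynomial (Fin r) K) :=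
  if 0 ≤ z then homogeneousSubmodule (Fin r) K z.toNat else ⊥

/-- The degree-`t` graded piece of the quotient `N = S^v / L` of the standardly graded
free module `S^v` by a homogeneous submodule `L`: the image of the degree-`t` piece
of `S^v`. -/
def piece {K : Type*} [Field K] {r v : ℕ}
    (L : Submodule (MvPolynomial (Fin r) K) (Fin v → MvPolynomial (Fin r) K)) (t : ℤ) :
    Submodule K ((Fin v → MvPolynomial (Fin r) K) ⧸ L) :=
  (Submodule.pi Set.univ fun _ => hcomp K r t).map (L.mkQ.restrictScalars K)

/-- `L ⊆ S^v` is generated by homogeneous elements of positive degree. -/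
def posDegGen {K : Type*} [Field K] {r v : ℕ}
    (L : Submodule (MvPolynomial (Fin r) K) (Fin v → MvPolynomial (Fin r) K)) : Prop :=
  ∃ G : Set (Fin v → MvPolynomial (Fin r) K),
    L = Submodule.span (MvPolynomial (Fin r) K) G ∧
    ∀ w ∈ G, ∃ e : ℕ, 0 < e ∧ ∀ i, (w i).IsHomogeneous e

end

section GradedPairing

variable {K N : Type*} [Field K] [AddCommGroup N] [Module K N] {P : ℤ → Submodule K N}

lemma eq_zero_of_forall_mem_of_iSup_eq_top (hP : ⨆ t, P t = ⊤) {φ : Module.Dual K N}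
    (h : ∀ i, ∀ y ∈ P i, φ y = 0) : φ = 0 := by
  have hker : (⊤ : Submodule K N) ≤ LinearMap.ker φ := hP ▸ iSup_le h
  ext y
  exact hker Submodule.mem_top

variable {τ : N →ₗ[K] Module.Dual K N} {s : ℤ}

lemma apply_eq_zero_of_mem_iSup_ne
    (hgr : ∀ j, ∀ x ∈ P j, ∀ i, i ≠ s - j → ∀ y ∈ P i, τ x y = 0) {t : ℤ} {b : N}
    (hb : b ∈ ⨆ i, ⨆ _ : i ≠ t, P i) {y : N} (hy : y ∈ P (s - t)) : τ b y = 0 := by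
  have hle : (⨆ i, ⨆ _ : i ≠ t, P i) ≤ LinearMap.ker (τ.flip y) :=
    iSup₂_le fun i hi x hx => hgr i x hx (s - t) (by omega) y hy
  exact hle hb

/-- If `f` is injective on degree `t`, its adjoint is surjective onto the dual degree. -/
lemma surjective_of_injective_of_pairing (hP : ⨆ t, P t = ⊤) (hτ : Function.Bijective τ)
    (hgr : ∀ j, ∀ x ∈ P j, ∀ i, i ≠ s - j → ∀ y ∈ P i, τ x y = 0)
    {f : N →ₗ[K] N} (hf : ∀ x y, τ (f x) y = τ x (f y))
    (hfP : ∀ t, ∀ x ∈ P t, f x ∈ P (t + 1)) {t u : ℤ} (hu : u = s - t - 1)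
    (hinj : ∀ x ∈ P t, f x = 0 → x = 0) :
    ∀ y ∈ P (u + 1), ∃ x ∈ P u, f x = y := by
  obtain rfl : s = t + u + 1 := by omega
  have hzero : ∀ x, (∀ i, ∀ y ∈ P i, τ x y = 0) → x = 0 := fun x hx =>
    hτ.1 (by rw [eq_zero_of_forall_mem_of_iSup_eq_top hP hx, map_zero])
  intro y hy
  by_contra hne
  have hyW : y ∉ (P u).map f ⊔ ⨆ i, ⨆ _ : i ≠ u + 1, P i := by
    intro hmem
    obtain ⟨_, ⟨z, hz, rfl⟩, b, hb, rfl⟩ := Submodule.mem_sup.1 hmem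
    refine hne ⟨z, hz, ?_⟩
    have hbP : b ∈ P (u + 1) := by
      simpa using (P (u + 1)).sub_mem hy (hfP u z hz)
    have hb0 : b = 0 := hzero b fun i w hw => by
      by_cases hi : i = t + u + 1 - (u + 1)
      · subst hi
        exact apply_eq_zero_of_mem_iSup_ne hgr hb hw
      · exact hgr _ b hbP i hi w hw
    rw [hb0, add_zero]
  obtain ⟨φ, hφy, hφW⟩ := Submodule.exists_le_ker_of_notMem hyW
  obtain ⟨x, rfl⟩ := hτ.2 φ
  have hx_ne : ∀ i, i ≠ u + 1 → ∀ w ∈ P i, τ x w = 0 := fun i hi w hw =>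
    hφW (Submodule.mem_sup_right (Submodule.mem_iSup_of_mem i (Submodule.mem_iSup_of_mem hi hw)))
  have hxmem : x ∈ P t := by
    have hx : x ∈ P t ⊔ ⨆ i, ⨆ _ : i ≠ t, P i := by
      have htop : P t ⊔ ⨆ i, ⨆ _ : i ≠ t, P i = ⊤ := by
        rw [eq_top_iff, ← hP]
        refine iSup_le fun i => ?_
        by_cases hi : i = t
        · exact hi ▸ le_sup_left
        · exact (le_iSup₂ (f := fun i (_ : i ≠ t) => P i) i hi).trans le_sup_right
      exact htop ▸ Submodule.mem_top
    obtain ⟨a, ha, b, hb, rfl⟩ := Submodule.mem_sup.1 hx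
    have hb0 : b = 0 := hzero b fun i w hw => by
      by_cases hi : i = t + u + 1 - t
      · subst hi
        exact apply_eq_zero_of_mem_iSup_ne hgr hb hw
      · have h1 := hx_ne i (by omega) w hw
        rwa [map_add, LinearMap.add_apply, hgr t a ha i hi w hw, zero_add] at h1
    rwa [hb0, add_zero]
  have hfx : f x = 0 := hzero _ fun i w hw => by
    by_cases hi : i = u
    · subst hi
      rw [hf]
      exact hφW (Submodule.mem_sup_left ⟨w, hw, rfl⟩)
    · exact hgr _ _ (hfP t x hxmem) i (by omega) w hw
  exact hφy (by rw [hinj x hxmem hfx, map_zero, LinearMap.zero_apply])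

/-- If `f` is surjective onto degree `t + 1`, its adjoint is injective on the dual degree. -/
lemma injective_of_surjective_of_pairing (hP : ⨆ t, P t = ⊤) (hτ : Function.Injective τ)
    (hgr : ∀ j, ∀ x ∈ P j, ∀ i, i ≠ s - j → ∀ y ∈ P i, τ x y = 0)
    {f : N →ₗ[K] N} (hf : ∀ x y, τ (f x) y = τ x (f y)) {t u : ℤ} (hu : u = s - t - 1)
    (hsurj : ∀ y ∈ P (t + 1), ∃ x ∈ P t, f x = y) :
    ∀ x ∈ P u, f x = 0 → x = 0 := by
  intro x hx hfx
  refine hτ ?_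
  rw [map_zero]
  refine eq_zero_of_forall_mem_of_iSup_eq_top hP fun i y hy => ?_
  by_cases hi : i = t + 1
  · subst hi
    obtain ⟨z, -, rfl⟩ := hsurj y hy
    rw [← hf, hfx, map_zero, LinearMap.zero_apply]
  · exact hgr u x hx i (by omega) y hy

lemma socle_degree_eq (hP : ⨆ t, P t = ⊤) (hτ : Function.Injective τ)
    (hgr : ∀ j, ∀ x ∈ P j, ∀ i, i ≠ s - j → ∀ y ∈ P i, τ x y = 0)
    {c : ℤ} (h0 : P 0 ≠ ⊥) (hc : P c ≠ ⊥) (hneg : ∀ t < 0, P t = ⊥)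
    (htop : ∀ t, c < t → P t = ⊥) : s = c := by
  have hdual : ∀ t, P t ≠ ⊥ → P (s - t) ≠ ⊥ := by
    intro t ht hbot
    obtain ⟨x, hx, hx0⟩ := Submodule.exists_mem_ne_zero_of_ne_bot ht
    refine hx0 (hτ ?_)
    rw [map_zero]
    refine eq_zero_of_forall_mem_of_iSup_eq_top hP fun i y hy => ?_
    by_cases hi : i = s - t
    · subst hi
      rw [hbot, Submodule.mem_bot] at hy
      rw [hy, map_zero]
    · exact hgr t x hx i hi y hy
  have h1 : ¬ c < s - 0 := fun h => hdual 0 h0 (htop _ h)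
  have h2 : ¬ s - c < 0 := fun h => hdual c hc (hneg _ h)
  omega

end GradedPairing

section Piece

variable {K : Type*} [Field K] {r v : ℕ}
  (L : Submodule (MvPolynomial (Fin r) K) (Fin v → MvPolynomial (Fin r) K))

lemma mem_piece_natCast {n : ℕ} {y : (Fin v → MvPolynomial (Fin r) K) ⧸ L} :
    y ∈ piece L (n : ℤ) ↔ ∃ w : Fin v → MvPolynomial (Fin r) K,
      (∀ i, (w i).IsHomogeneous n) ∧ L.mkQ w = y := by
  simp [piece, hcomp, Submodule.mem_map, Submodule.mem_pi]

lemma piece_of_neg {t : ℤ} (ht : t < 0) : piece L t = ⊥ := by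
  rw [eq_bot_iff]
  rintro _ ⟨w, hw, rfl⟩
  have hw0 : w = 0 := by
    ext1 i
    have hi : w i ∈ hcomp K r t := hw i (Set.mem_univ i)
    rwa [hcomp, if_neg (by omega), Submodule.mem_bot] at hi
  simp [hw0]

lemma smul_mem_piece {ℓ : MvPolynomial (Fin r) K} (hℓ : ℓ.IsHomogeneous 1) (t : ℤ)
    {x : (Fin v → MvPolynomial (Fin r) K) ⧸ L} (hx : x ∈ piece L t) :
    ℓ • x ∈ piece L (t + 1) := by
  rcases lt_or_ge t 0 with ht | ht
  · rw [piece_of_neg L ht, Submodule.mem_bot] at hx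
    rw [hx, smul_zero]
    exact zero_mem _
  · lift t to ℕ using ht
    obtain ⟨w, hw, rfl⟩ := (mem_piece_natCast L).1 hx
    have h : L.mkQ (ℓ • w) ∈ piece L ((t + 1 : ℕ) : ℤ) :=
      (mem_piece_natCast L).2 ⟨ℓ • w, fun i => add_comm 1 t ▸ hℓ.mul (hw i), rfl⟩
    simpa using h

lemma mkQ_single_monomial_mem_piece (k : Fin v) (m : Fin r →₀ ℕ) (a : K) :
    L.mkQ (Pi.single k (monomial m a)) ∈ piece L (m.degree : ℤ) := by
  refine (mem_piece_natCast L).2 ⟨_, fun i => ?_, rfl⟩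
  rcases eq_or_ne i k with rfl | hi
  · simpa using isHomogeneous_monomial a rfl
  · simpa [hi] using isHomogeneous_zero (Fin r) K m.degree

lemma mkQ_mem_of_monomials (Q : Submodule K ((Fin v → MvPolynomial (Fin r) K) ⧸ L))
    (w : Fin v → MvPolynomial (Fin r) K)
    (h : ∀ k, ∀ m ∈ (w k).support, ∀ a : K, L.mkQ (Pi.single k (monomial m a)) ∈ Q) :
    L.mkQ w ∈ Q := by
  rw [← Finset.univ_sum_single w, map_sum]
  refine Q.sum_mem fun k _ => ?_
  have hsum : Pi.single k (w k) = ∑ m ∈ (w k).support,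
      (Pi.single k (monomial m (coeff m (w k))) : Fin v → MvPolynomial (Fin r) K) := by
    conv_lhs => rw [(w k).as_sum]
    exact map_sum (AddMonoidHom.single (fun _ : Fin v => MvPolynomial (Fin r) K) k) _ _
  rw [hsum, map_sum]
  exact Q.sum_mem fun m hm => h k m hm _

lemma iSup_piece : ⨆ t, piece L t = ⊤ := by
  rw [eq_top_iff]
  rintro y -
  obtain ⟨w, rfl⟩ := L.mkQ_surjective y
  exact mkQ_mem_of_monomials L _ w fun k m _ a =>
    Submodule.mem_iSup_of_mem _ (mkQ_single_monomial_mem_piece L k m a)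

lemma smul_surjective_succ {ℓ : MvPolynomial (Fin r) K} {t : ℤ} (ht : 0 ≤ t)
    (h : ∀ y ∈ piece L (t + 1), ∃ x ∈ piece L t, ℓ • x = y) :
    ∀ y ∈ piece L (t + 1 + 1), ∃ x ∈ piece L (t + 1), ℓ • x = y := by
  lift t to ℕ using ht
  intro y hy
  obtain ⟨w, hw, rfl⟩ := (mem_piece_natCast L (n := t + 1 + 1)).1 (by exact_mod_cast hy)
  suffices L.mkQ w ∈ (piece L (t + 1)).map (Algebra.lsmul K K _ ℓ) from this
  refine mkQ_mem_of_monomials L _ w fun k m hm a => ?_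
  have hdeg : m.degree = t + 1 + 1 := by
    by_contra hne
    exact mem_support_iff.1 hm ((hw k).coeff_eq_zero hne)
  obtain ⟨i, hi⟩ : ∃ i, m i ≠ 0 := by
    by_contra! hall
    have : m = 0 := Finsupp.ext hall
    simp [this] at hdeg
  obtain ⟨m', rfl⟩ : ∃ m', m = Finsupp.single i 1 + m' :=
    ⟨m - Finsupp.single i 1, (add_tsub_cancel_of_le (by
      simpa [Nat.one_le_iff_ne_zero] using hi)).symm⟩
  have hm' : m'.degree = t + 1 := by
    rw [map_add, Finsupp.degree_single] at hdeg
    omega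
  obtain ⟨x, hx, hxy⟩ := h (L.mkQ (Pi.single k (monomial m' a)))
    (by have := mkQ_single_monomial_mem_piece L k m' a; rw [hm'] at this; exact_mod_cast this)
  refine ⟨(X i : MvPolynomial (Fin r) K) • x, smul_mem_piece L (isHomogeneous_X K i) _ hx, ?_⟩
  have hmul : (Pi.single k (monomial (Finsupp.single i 1 + m') a) :
      Fin v → MvPolynomial (Fin r) K) = (X i : MvPolynomial (Fin r) K) •
        Pi.single k (monomial m' a) := by
    rw [← Pi.single_smul, smul_eq_mul, X, monomial_mul, one_mul]
  rw [Algebra.lsmul_coe, hmul, L.mkQ.map_smul, ← hxy, smul_comm]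

lemma smul_surjective_of_le {ℓ : MvPolynomial (Fin r) K} {t u : ℤ} (ht : 0 ≤ t) (htu : t ≤ u)
    (h : ∀ y ∈ piece L (t + 1), ∃ x ∈ piece L t, ℓ • x = y) :
    ∀ y ∈ piece L (u + 1), ∃ x ∈ piece L u, ℓ • x = y := by
  induction u, htu using Int.leInduction with
  | base => exact h
  | succ u hu ih => exact smul_surjective_succ L (ht.trans hu) ih

end Piece

/-- Let `N = N₀ ⊕ … ⊕ N_c = S^v/L` be an Artinian graded module
generated in degree zero (`L` homogeneous, generated in positive degrees), with
`N₀ ≠ 0` and `N_c ≠ 0`, and suppose `N` is Symmetrically Gorenstein (for some `s`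
there is a symmetric graded `S`-module isomorphism `τ : N → N^∨(-s)`, encoded as
in the hypotheses below).  Set `j = ⌊(c-1)/2⌋`.  Then, as sets, `𝔏_N = 𝔏_{N,j}`;
that is, a linear form `ℓ ∈ S₁` is a Lefschetz element of `N` if and only if
`×ℓ : N_j → N_{j+1}` has maximal rank (is injective or surjective).
(Note that `/` on `ℤ` is floor division by a positive integer.) -/
theorem stmt18 {K : Type*} [Field K] [IsAlgClosed K] [CharZero K] (r v : ℕ)
    (L : Submodule (MvPolynomial (Fin r) K) (Fin v → MvPolynomial (Fin r) K))
    (hL : posDegGen L)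
    (hart : IsArtinian (MvPolynomial (Fin r) K) ((Fin v → MvPolynomial (Fin r) K) ⧸ L))
    -- `N = N₀ ⊕ … ⊕ N_c` with `N₀ ≠ 0` and `N_c ≠ 0`
    (c : ℤ) (h0 : piece L 0 ≠ ⊥) (hc : piece L c ≠ ⊥)
    (htop : ∀ t : ℤ, c < t → piece L t = ⊥)
    -- `N` is Symmetrically Gorenstein
    (hSG : ∃ (s : ℤ) (τ : ((Fin v → MvPolynomial (Fin r) K) ⧸ L) →ₗ[K]
        Module.Dual K ((Fin v → MvPolynomial (Fin r) K) ⧸ L)),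
      Function.Bijective τ ∧
      (∀ (p : MvPolynomial (Fin r) K) (x y : (Fin v → MvPolynomial (Fin r) K) ⧸ L),
        τ (p • x) y = τ x (p • y)) ∧
      (∀ x y : (Fin v → MvPolynomial (Fin r) K) ⧸ L, τ x y = τ y x) ∧
      (∀ j : ℤ, ∀ x ∈ piece L j, ∀ i : ℤ, i ≠ s - j → ∀ y ∈ piece L i, τ x y = 0)) :
    ∀ ℓ : MvPolynomial (Fin r) K, ℓ.IsHomogeneous 1 →
      ((∀ t : ℤ,
          (∀ x ∈ piece L t, ℓ • x = 0 → x = 0) ∨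
          (∀ y ∈ piece L (t + 1), ∃ x ∈ piece L t, ℓ • x = y)) ↔
        ((∀ x ∈ piece L ((c - 1) / 2), ℓ • x = 0 → x = 0) ∨
          (∀ y ∈ piece L ((c - 1) / 2 + 1), ∃ x ∈ piece L ((c - 1) / 2), ℓ • x = y))) := by
  intro ℓ hℓ
  refine ⟨fun h => h _, fun h t => ?_⟩
  obtain ⟨s, τ, hτ, hadj, -, hgr⟩ := hSG
  have hP := iSup_piece L
  obtain rfl : s = c :=
    socle_degree_eq hP hτ.1 hgr h0 hc (fun t ht => piece_of_neg L ht) htop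
  have hs : 0 ≤ s := by
    by_contra hneg
    exact h0 (htop 0 (by omega))
  set f := Algebra.lsmul K K ((Fin v → MvPolynomial (Fin r) K) ⧸ L) ℓ
  have hf : ∀ x y, τ (f x) y = τ x (f y) := hadj ℓ
  have hsurj_inj : ∀ {t u : ℤ}, u = s - t - 1 →
      (∀ y ∈ piece L (t + 1), ∃ x ∈ piece L t, ℓ • x = y) →
      ∀ x ∈ piece L u, ℓ • x = 0 → x = 0 := fun hu h =>
    injective_of_surjective_of_pairing hP hτ.1 hgr hf hu h
  rcases hs.eq_or_lt with rfl | hs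
  · rcases lt_or_ge t 0 with ht | ht
    · left
      intro x hx _
      rwa [piece_of_neg L ht, Submodule.mem_bot] at hx
    · right
      intro y hy
      rw [htop (t + 1) (by omega), Submodule.mem_bot] at hy
      exact ⟨0, zero_mem _, by rw [hy, smul_zero]⟩
  · set j := (s - 1) / 2 with hj
    have hsurj : ∀ y ∈ piece L (s - j - 1 + 1), ∃ x ∈ piece L (s - j - 1), ℓ • x = y := by
      rcases h with h | h
      · exact surjective_of_injective_of_pairing hP hτ hgr hf
          (fun t x hx => smul_mem_piece L hℓ t hx) rfl h
      · exact smul_surjective_of_le L (by omega) (by omega) h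
    rcases le_or_gt t j with ht | ht
    · exact .inl (hsurj_inj (t := s - t - 1) (by omega)
        (smul_surjective_of_le L (by omega) (by omega) hsurj))
    · exact .inr (smul_surjective_of_le L (by omega) (by omega) hsurj)
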